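/- In the setting of part (2) of Yang–Stufken's complete class theorem, suppose additionally that k is even and that the index of ξ satisfies I(ξ) ≥ k/2. Then the improving design ξ⁻ can be chosen to have at most k/2 support points; that is, there exists a finitely supported probability measure ξ⁻ on [A,B] with at most k/2 support points such that ∫_A^B Ψ_i dξ⁻ = ∫_A^B Ψ_i dξ for all i = 0,…,k−1 and ∫_A^B C₂₂ dξ⁻ − ∫_A^B C₂₂ dξ is positive semidefinite. -/

import Mathlib

open MeasureTheory Set Matrix

/-- A family of functions `Ψ₀, …, Ψ_{k-1}` is a Chebyshev system on `[A,B]` if for all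
points `A ≤ x₀ < x₁ < ⋯ < x_{k-1} ≤ B` the matrix `(Ψ i (x j))` has positive determinant. -/
def IsChebyshevSystem (A B : ℝ) {k : ℕ} (Ψ : Fin k → ℝ → ℝ) : Prop :=
  ∀ x : Fin k → ℝ, StrictMono x → (∀ j, x j ∈ Set.Icc A B) →
    0 < (Matrix.of fun i j : Fin k => Ψ i (x j)).det

/-- `ξ` is a design on `[A,B]`: a finitely supported probability measure
`ξ = ∑_{x ∈ s} w_x δ_x` with support points `s ⊆ [A,B]` and positive weights. -/
def IsDesignOn (A B : ℝ) (ξ : Measure ℝ) (s : Finset ℝ) : Prop :=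
  IsProbabilityMeasure ξ ∧ ↑s ⊆ Set.Icc A B ∧ (∀ x ∈ s, 0 < ξ {x}) ∧
    ξ = ∑ x ∈ s, ξ {x} • Measure.dirac x

/-- The entrywise integral `∫ C₂₂(x) dξ(x)` of a matrix-valued function. -/
noncomputable def matrixIntegral {p₁ : ℕ} (C : ℝ → Matrix (Fin p₁) (Fin p₁) ℝ)
    (ξ : Measure ℝ) : Matrix (Fin p₁) (Fin p₁) ℝ :=
  Matrix.of fun a b => ∫ x, C x a b ∂ξ

open Classical in
/-- The index of a design with support `s` on `[A,B]`: the number of support points in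
the open interval `(A,B)` plus one half times the number of support points among the
endpoints `{A, B}`. -/
noncomputable def designIndex (A B : ℝ) (s : Finset ℝ) : ℝ :=
  ((s.filter fun x => x ∈ Set.Ioo A B).card : ℝ) +
    ((s.filter fun x => x = A ∨ x = B).card : ℝ) / 2

/-- The convex hull of a compact subset of a finite-dimensional space is compact. -/
theorem IsCompact.convexHull_of_finiteDimensional {E : Type*} [AddCommGroup E] [Module ℝ E]
    [TopologicalSpace E] [ContinuousAdd E] [ContinuousSMul ℝ E] [FiniteDimensional ℝ E]
    {K : Set E} (hK : IsCompact K) : IsCompact (convexHull ℝ K) := by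
  set N := Module.finrank ℝ E + 1
  have hcomp : IsCompact (stdSimplex ℝ (Fin N) ×ˢ Set.univ.pi fun _ : Fin N => K) :=
    (isCompact_stdSimplex ℝ _).prod (isCompact_univ_pi fun _ => hK)
  have hcont : Continuous fun p : (Fin N → ℝ) × (Fin N → E) => ∑ j, p.1 j • p.2 j := by fun_prop
  convert hcomp.image hcont using 1
  ext x
  constructor
  · intro hx
    obtain ⟨ι, _, z, w, hz, hind, hw, hw1, rfl⟩ := eq_pos_convex_span_of_mem_convexHull hx
    have hcard : Fintype.card ι ≤ Fintype.card (Fin N) := by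
      simpa [N] using hind.card_le_finrank_succ.trans
        (Nat.succ_le_succ (Submodule.finrank_le (vectorSpan ℝ (Set.range z))))
    obtain ⟨f⟩ := Function.Embedding.nonempty_of_card_le hcard
    have hne : Nonempty ι := by
      by_contra h
      rw [not_nonempty_iff] at h
      simp at hw1
    obtain ⟨i₀⟩ := hne
    refine ⟨(Function.extend f w 0, Function.extend f z fun _ => z i₀), ⟨⟨fun j => ?_, ?_⟩,
      fun j _ => ?_⟩, ?_⟩
    · by_cases hj : ∃ i, f i = j
      · obtain ⟨i, rfl⟩ := hj
        simpa [f.injective.extend_apply] using (hw i).le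
      · simp [Function.extend_apply' _ _ _ hj]
    · rw [← hw1]
      refine (Fintype.sum_of_injective f f.injective _ _ (fun j hj => ?_) fun i => ?_).symm
      · exact Function.extend_apply' _ _ _ hj
      · exact (f.injective.extend_apply _ _ _).symm
    · by_cases hj : ∃ i, f i = j
      · obtain ⟨i, rfl⟩ := hj
        simpa [f.injective.extend_apply] using hz ⟨i, rfl⟩
      · simpa [Function.extend_apply' _ _ _ hj] using hz ⟨i₀, rfl⟩
    · refine (Fintype.sum_of_injective f f.injective _ _ (fun j hj => ?_) fun i => ?_).symm
      · simp [Function.extend_apply' _ _ _ hj]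
      · simp [f.injective.extend_apply]
  · rintro ⟨⟨w, z⟩, ⟨hw, hz⟩, rfl⟩
    exact (convex_convexHull ℝ K).sum_mem (fun j _ => hw.1 j) hw.2
      fun j _ => subset_convexHull ℝ K (hz j trivial)

/-- A point of the convex hull of a parametrized curve is a positive combination of finitely many
points of the curve. -/
theorem exists_finset_weights_of_mem_convexHull_image {α : Type*} {n : ℕ} {K : Set α}
    {γ : α → Fin n → ℝ} {p : Fin n → ℝ} (hp : p ∈ convexHull ℝ (γ '' K)) :
    ∃ (t : Finset α) (w : α → ℝ), ↑t ⊆ K ∧ (∀ x ∈ t, 0 < w x) ∧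
      ∀ i, ∑ x ∈ t, w x * γ x i = p i := by
  classical
  obtain ⟨ι, _, z, w, hz, hind, hw, hw1, rfl⟩ := eq_pos_convex_span_of_mem_convexHull hp
  choose y hyK hy using fun i => hz ⟨i, rfl⟩
  have hinj : Function.Injective y := fun i j hij => hind.injective (by rw [← hy, ← hy, hij])
  refine ⟨Finset.univ.image y, Function.extend y w 0, ?_, ?_, fun i => ?_⟩
  · intro x hx
    obtain ⟨i, rfl⟩ := by simpa using hx
    exact hyK i
  · intro x hx
    obtain ⟨i, rfl⟩ := by simpa using hx
    rw [hinj.extend_apply]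
    exact hw i
  · rw [Finset.sum_image hinj.injOn]
    simp [hinj.extend_apply, hy, Finset.sum_apply]

/-- For points `y₀ < ⋯ < y_k` there are coefficients with alternating signs, negative at the last
point when `k` is even, that annihilate the first `k` functions of a Chebyshev system and make the
last one negative. -/
theorem IsChebyshevSystem.exists_alternating {A B : ℝ} {k : ℕ} {Φ : Fin (k + 1) → ℝ → ℝ}
    (hΦ : IsChebyshevSystem A B Φ) (hΦ' : IsChebyshevSystem A B fun i : Fin k => Φ i.castSucc)
    {y : Fin (k + 1) → ℝ} (hy : StrictMono y) (hyAB : ∀ j, y j ∈ Set.Icc A B) (hk : Even k) :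
    ∃ σ : Fin (k + 1) → ℝ, (∀ j : Fin (k + 1), Odd (j : ℕ) → 0 < σ j) ∧
      (∀ i : Fin k, ∑ j, σ j * Φ i.castSucc (y j) = 0) ∧
      ∑ j, σ j * Φ (Fin.last k) (y j) < 0 := by
  set D : Fin (k + 1) → ℝ := fun j =>
    (Matrix.of fun i l : Fin k => Φ i.castSucc (y (j.succAbove l))).det
  have hD : ∀ j, 0 < D j := fun j =>
    hΦ' _ (hy.comp (Fin.strictMono_succAbove j)) fun l => hyAB _
  have hlap : ∀ g : ℝ → ℝ, ∑ j : Fin (k + 1), -((-1) ^ (j : ℕ) * D j) * g (y j) =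
      -(Matrix.of fun i l : Fin (k + 1) =>
        (Fin.snoc (fun i : Fin k => Φ i.castSucc) g : Fin (k + 1) → ℝ → ℝ) i (y l)).det := by
    intro g
    rw [Matrix.det_succ_row _ (Fin.last k), ← Finset.sum_neg_distrib]
    refine Finset.sum_congr rfl fun j _ => ?_
    have : (Matrix.of fun i l : Fin (k + 1) =>
        (Fin.snoc (fun i : Fin k => Φ i.castSucc) g : Fin (k + 1) → ℝ → ℝ) i (y l)).submatrix
          (Fin.last k).succAbove j.succAbove =
        Matrix.of fun i l : Fin k => Φ i.castSucc (y (j.succAbove l)) := by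
      ext i l
      simp
    rw [this]
    simp only [Matrix.of_apply, Fin.snoc_last, Fin.val_last, pow_add, hk.neg_one_pow, D]
    ring
  refine ⟨fun j => -((-1) ^ (j : ℕ) * D j), fun j hj => ?_, fun i => ?_, ?_⟩
  · simpa [hj.neg_one_pow] using hD j
  · rw [hlap, neg_eq_zero]
    refine Matrix.det_zero_of_row_eq (i := i.castSucc) (j := Fin.last k)
      (Fin.castSucc_lt_last i).ne ?_
    ext l
    simp
  · rw [hlap, neg_lt_zero]
    convert hΦ y hy hyAB using 5 with i l
    refine Fin.lastCases ?_ (fun i => ?_) i <;> simp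

/-- The first moments of a measure supported on few points determine it. -/
theorem IsChebyshevSystem.sum_eq_of_card_add_le {A B : ℝ} (hAB : A < B) {k : ℕ}
    {Ψ : Fin k → ℝ → ℝ} (hΨ : IsChebyshevSystem A B Ψ) {t₁ t₂ : Finset ℝ} {w₁ w₂ : ℝ → ℝ}
    (h₁ : ↑t₁ ⊆ Set.Icc A B) (h₂ : ↑t₂ ⊆ Set.Icc A B) (hcard : t₁.card + t₂.card ≤ k)
    (hmom : ∀ i, ∑ x ∈ t₁, w₁ x * Ψ i x = ∑ x ∈ t₂, w₂ x * Ψ i x) (g : ℝ → ℝ) :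
    ∑ x ∈ t₁, w₁ x * g x = ∑ x ∈ t₂, w₂ x * g x := by
  classical
  obtain ⟨T, hT, hTAB, hTk⟩ : ∃ T : Finset ℝ, t₁ ∪ t₂ ⊆ T ∧ ↑T ⊆ Set.Icc A B ∧ T.card = k := by
    have hinf : (Set.Icc A B \ ↑(t₁ ∪ t₂)).Infinite :=
      (Set.Icc_infinite hAB).sdiff (Finset.finite_toSet _)
    obtain ⟨u, hu, huc⟩ := hinf.exists_subset_card_eq (k - (t₁ ∪ t₂).card)
    refine ⟨(t₁ ∪ t₂) ∪ u, Finset.subset_union_left, ?_, ?_⟩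
    · rw [Finset.coe_union, Finset.coe_union]
      exact Set.union_subset (Set.union_subset h₁ h₂) (hu.trans Set.sdiff_subset)
    · have hdisj : Disjoint (t₁ ∪ t₂) u :=
        Finset.disjoint_left.2 fun x hx hxu => (hu hxu).2 hx
      have := Finset.card_union_le t₁ t₂
      rw [Finset.card_union_of_disjoint hdisj, huc]
      omega
  set d : ℝ → ℝ := fun x => (if x ∈ t₁ then w₁ x else 0) - if x ∈ t₂ then w₂ x else 0
  have hsum : ∀ f : ℝ → ℝ,
      ∑ j, d (T.orderEmbOfFin hTk j) * f (T.orderEmbOfFin hTk j) =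
        ∑ x ∈ t₁, w₁ x * f x - ∑ x ∈ t₂, w₂ x * f x := by
    intro f
    have hTi : T = Finset.univ.map (T.orderEmbOfFin hTk).toEmbedding := by simp
    have h1 : ∑ j, d (T.orderEmbOfFin hTk j) * f (T.orderEmbOfFin hTk j) =
        ∑ x ∈ T, d x * f x := by
      conv_rhs => rw [hTi, Finset.sum_map]
      rfl
    rw [h1]
    simp only [d, sub_mul, ite_mul, zero_mul, Finset.sum_sub_distrib, Finset.sum_ite_mem]
    rw [Finset.inter_eq_right.2 (Finset.subset_union_left.trans hT),
      Finset.inter_eq_right.2 (Finset.subset_union_right.trans hT)]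
  have hdet := (hΨ (T.orderEmbOfFin hTk) (T.orderEmbOfFin hTk).strictMono
    fun j => hTAB (T.orderEmbOfFin_mem hTk j)).ne'
  have hzero := Matrix.eq_zero_of_mulVec_eq_zero hdet
    (v := fun j => d (T.orderEmbOfFin hTk j)) (by
      ext i
      have := hsum (Ψ i)
      rw [hmom, sub_self] at this
      simpa [Matrix.mulVec, dotProduct, mul_comm] using this)
  have := hsum g
  simp only [fun j => congrFun hzero j, Pi.zero_apply, zero_mul, Finset.sum_const_zero] at this
  linarith

/-- A measure with more than `m` support points can be changed, preserving the first `2 m` moments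
of a Chebyshev system, so that the last moment decreases. -/
theorem IsChebyshevSystem.exists_lt_of_card_lt {A B : ℝ} {m : ℕ}
    {Φ : Fin (m + m + 1) → ℝ → ℝ} (hΦ : IsChebyshevSystem A B Φ)
    (hΦ' : IsChebyshevSystem A B fun i : Fin (m + m) => Φ i.castSucc)
    {t : Finset ℝ} {w : ℝ → ℝ} (ht : ↑t ⊆ Set.Icc A B) (hw : ∀ x ∈ t, 0 < w x)
    (hcard : m < t.card) :
    ∃ (T : Finset ℝ) (W : ℝ → ℝ), ↑T ⊆ Set.Icc A B ∧ (∀ x ∈ T, 0 ≤ W x) ∧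
      (∀ i : Fin (m + m), ∑ x ∈ T, W x * Φ i.castSucc x = ∑ x ∈ t, w x * Φ i.castSucc x) ∧
      ∑ x ∈ T, W x * Φ (Fin.last _) x < ∑ x ∈ t, w x * Φ (Fin.last _) x := by
  classical
  obtain ⟨t', ht', hc'⟩ := Finset.exists_subset_card_eq (Nat.succ_le_of_lt hcard)
  set e := t'.orderEmbOfFin hc'
  have he : ∀ i, e i ∈ t := fun i => ht' (t'.orderEmbOfFin_mem hc' i)
  set y : Fin (m + m + 1) → ℝ := fun j =>
    (e ⟨(j : ℕ) / 2, by omega⟩ + e ⟨((j : ℕ) + 1) / 2, by omega⟩) / 2 with hy_def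
  have hy : StrictMono y := by
    refine Fin.strictMono_iff_lt_succ.2 fun j => ?_
    have : e ⟨(j : ℕ) / 2, by omega⟩ < e ⟨((j : ℕ) + 1 + 1) / 2, by omega⟩ :=
      e.strictMono (Fin.mk_lt_mk.2 (by omega))
    simp only [hy_def, Fin.val_castSucc, Fin.val_succ]
    linarith
  have hyAB : ∀ j, y j ∈ Set.Icc A B := fun j => by
    have h1 := ht (he ⟨(j : ℕ) / 2, by omega⟩)
    have h2 := ht (he ⟨((j : ℕ) + 1) / 2, by omega⟩)
    constructor <;> simp only [hy_def] <;> linarith [h1.1, h1.2, h2.1, h2.2]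
  have hyeven : ∀ j : Fin (m + m + 1), ¬ Odd (j : ℕ) → y j ∈ t := fun j hj => by
    have h2 : ((j : ℕ) + 1) / 2 = (j : ℕ) / 2 := by
      rw [Nat.not_odd_iff_even, Nat.even_iff] at hj
      omega
    simpa only [hy_def, h2, add_self_div_two] using he ⟨(j : ℕ) / 2, by omega⟩
  obtain ⟨σ, hσpos, hσ0, hσneg⟩ := hΦ.exists_alternating hΦ' hy hyAB (Even.add_self m)
  obtain ⟨ε, hεσ, hε⟩ : ∃ ε : ℝ,
      (∀ j : Fin (m + m + 1), ¬ Odd (j : ℕ) → 0 < w (y j) + ε * σ j) ∧ 0 < ε := by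
    have hev : ∀ j : Fin (m + m + 1), ∀ᶠ ε in nhdsWithin (0 : ℝ) (Set.Ioi 0),
        ¬ Odd (j : ℕ) → 0 < w (y j) + ε * σ j := by
      intro j
      by_cases hj : Odd (j : ℕ)
      · simp [hj]
      · have hc : Continuous fun ε : ℝ => w (y j) + ε * σ j := by fun_prop
        have := (hc.tendsto 0).eventually
          (Ioi_mem_nhds (by simpa using hw _ (hyeven j hj) : 0 < w (y j) + 0 * σ j))
        exact (this.filter_mono nhdsWithin_le_nhds).mono fun ε h _ => h
    exact ((Filter.eventually_all.2 hev).and self_mem_nhdsWithin).exists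
  set W : ℝ → ℝ := fun x => (if x ∈ t then w x else 0) + ε * ∑ j, if y j = x then σ j else 0
  have hsum : ∀ f : ℝ → ℝ, ∑ x ∈ t ∪ Finset.univ.image y, W x * f x =
      ∑ x ∈ t, w x * f x + ε * ∑ j, σ j * f (y j) := by
    intro f
    simp only [W, add_mul, Finset.sum_add_distrib, ite_mul, zero_mul, Finset.sum_ite_mem]
    congr 1
    · rw [Finset.inter_eq_right.2 Finset.subset_union_left]
    · simp only [mul_assoc, ← Finset.mul_sum, Finset.sum_mul, ite_mul, zero_mul]
      rw [Finset.sum_comm]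
      congr 1
      refine Finset.sum_congr rfl fun j _ => ?_
      rw [Finset.sum_ite_eq, if_pos]
      exact Finset.mem_union_right _ (Finset.mem_image_of_mem y (Finset.mem_univ j))
  refine ⟨t ∪ Finset.univ.image y, W, ?_, fun x hx => ?_, fun i => ?_, ?_⟩
  · intro x hx
    rcases Finset.mem_union.1 hx with hx | hx
    · exact ht hx
    · obtain ⟨j, -, rfl⟩ := Finset.mem_image.1 hx
      exact hyAB j
  · by_cases hxy : ∃ j, y j = x
    · obtain ⟨j, rfl⟩ := hxy
      simp only [W, hy.injective.eq_iff, Finset.sum_ite_eq', Finset.mem_univ, if_true]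
      by_cases hj : Odd (j : ℕ)
      · have h1 : 0 ≤ if y j ∈ t then w (y j) else 0 := by
          split_ifs with h
          exacts [(hw _ h).le, le_rfl]
        have := mul_pos hε (hσpos j hj)
        linarith
      · rw [if_pos (hyeven j hj)]
        exact (hεσ j hj).le
    · have hxt : x ∈ t := (Finset.mem_union.1 hx).resolve_right fun h => by
        obtain ⟨j, -, hj⟩ := Finset.mem_image.1 h
        exact hxy ⟨j, hj⟩
      push Not at hxy
      simpa [W, hxy, hxt] using (hw x hxt).le
  · rw [hsum, hσ0, mul_zero, add_zero]
  · rw [hsum]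
    linarith [mul_neg_of_pos_of_neg hε hσneg]

/-- Among the measures with given first `2 m` moments there is one with at most `m` support points
which does not increase the last moment. -/
theorem IsChebyshevSystem.exists_card_le {A B : ℝ} {m : ℕ}
    {Φ : Fin (m + m + 1) → ℝ → ℝ} (hΦ : IsChebyshevSystem A B Φ)
    (hΦ' : IsChebyshevSystem A B fun i : Fin (m + m) => Φ i.castSucc)
    (hcont : ∀ i, ContinuousOn (Φ i) (Set.Icc A B))
    {i₀ : Fin (m + m)} (hone : ∀ x, Φ i₀.castSucc x = 1)
    {s : Finset ℝ} {v : ℝ → ℝ} (hs : ↑s ⊆ Set.Icc A B) (hv : ∀ x ∈ s, 0 ≤ v x)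
    (hv1 : ∑ x ∈ s, v x = 1) :
    ∃ (t : Finset ℝ) (w : ℝ → ℝ), ↑t ⊆ Set.Icc A B ∧ (∀ x ∈ t, 0 < w x) ∧ t.card ≤ m ∧
      (∀ i : Fin (m + m), ∑ x ∈ t, w x * Φ i.castSucc x = ∑ x ∈ s, v x * Φ i.castSucc x) ∧
      ∑ x ∈ t, w x * Φ (Fin.last _) x ≤ ∑ x ∈ s, v x * Φ (Fin.last _) x := by
  set γ : ℝ → Fin (m + m + 1) → ℝ := fun x i => Φ i x
  have hγ : ContinuousOn γ (Set.Icc A B) := continuousOn_pi.2 hcont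
  set H := convexHull ℝ (γ '' Set.Icc A B)
  have hH : IsCompact H := (isCompact_Icc.image_of_continuousOn hγ).convexHull_of_finiteDimensional
  have hmem : ∀ (T : Finset ℝ) (W : ℝ → ℝ), ↑T ⊆ Set.Icc A B → (∀ x ∈ T, 0 ≤ W x) →
      ∑ x ∈ T, W x = 1 → (fun i => ∑ x ∈ T, W x * Φ i x) ∈ H := by
    intro T W hT hW hW1
    have := (convex_convexHull ℝ (γ '' Set.Icc A B)).sum_mem hW hW1
      fun x hx => subset_convexHull ℝ _ (Set.mem_image_of_mem γ (hT hx))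
    convert this using 1
    ext i
    simp [γ, Finset.sum_apply]
  set F : Set (Fin (m + m + 1) → ℝ) :=
    {p | ∀ i : Fin (m + m), p i.castSucc = ∑ x ∈ s, v x * Φ i.castSucc x}
  have hF : IsClosed F := by
    simp only [F, Set.ofPred_forall]
    exact isClosed_iInter fun i => isClosed_eq (continuous_apply _) continuous_const
  obtain ⟨p, ⟨hpH, hpF⟩, hpmin⟩ := (hH.inter_right hF).exists_isMinOn
    ⟨_, hmem s v hs hv hv1, fun i => rfl⟩ (continuous_apply (Fin.last (m + m))).continuousOn
  obtain ⟨t, w, ht, hw, htw⟩ := exists_finset_weights_of_mem_convexHull_image hpH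
  have htmom : ∀ i : Fin (m + m), ∑ x ∈ t, w x * Φ i.castSucc x =
      ∑ x ∈ s, v x * Φ i.castSucc x := fun i => (htw i.castSucc).trans (hpF i)
  refine ⟨t, w, ht, hw, ?_, htmom, (htw (Fin.last _)).trans_le
    (hpmin ⟨hmem s v hs hv hv1, fun i => rfl⟩)⟩
  by_contra! hcard
  obtain ⟨T, W, hT, hW, hWmom, hWlt⟩ := hΦ.exists_lt_of_card_lt hΦ' ht hw hcard
  have hW1 : ∑ x ∈ T, W x = 1 := by
    have := (hWmom i₀).trans (htmom i₀)
    simpa [hone, hv1] using this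
  have hle := hpmin (⟨hmem T W hT hW hW1, fun i => (hWmom i).trans (htmom i)⟩ : _ ∈ H ∩ F)
  exact absurd ((htw (Fin.last _)).trans_le hle) hWlt.not_ge

/-- The integral against a design is the weighted sum over its support points. -/
theorem IsDesignOn.integral_eq {A B : ℝ} {ξ : Measure ℝ} {s : Finset ℝ}
    (hξ : IsDesignOn A B ξ s) (f : ℝ → ℝ) : ∫ x, f x ∂ξ = ∑ x ∈ s, ξ.real {x} * f x := by
  have := hξ.1
  conv_lhs => rw [hξ.2.2.2]
  rw [integral_finsetSum_measure fun x _ =>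
    (integrable_dirac (by simp)).smul_measure (measure_ne_top ξ _)]
  simp [integral_smul_measure, Measure.real]

/-- Positive weights with total mass one define a design. -/
theorem exists_isDesignOn {A B : ℝ} {t : Finset ℝ} {w : ℝ → ℝ} (ht : ↑t ⊆ Set.Icc A B)
    (hw : ∀ x ∈ t, 0 < w x) (hw1 : ∑ x ∈ t, w x = 1) :
    ∃ ξ : Measure ℝ, IsDesignOn A B ξ t ∧ ∀ x ∈ t, ξ.real {x} = w x := by
  set ξ : Measure ℝ := ∑ x ∈ t, ENNReal.ofReal (w x) • Measure.dirac x with hξ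
  have hat : ∀ x ∈ t, ξ {x} = ENNReal.ofReal (w x) := by
    intro x hx
    simp only [hξ, Measure.finsetSum_apply, Measure.smul_apply, smul_eq_mul]
    rw [Finset.sum_eq_single x (fun y _ hyx => by simp [hyx]) fun h => absurd hx h]
    simp
  refine ⟨ξ, ⟨⟨?_⟩, ht, fun x hx => ?_, ?_⟩, fun x hx => ?_⟩
  · simp only [hξ, Measure.finsetSum_apply, Measure.smul_apply, smul_eq_mul, measure_univ, mul_one]
    rw [← ENNReal.ofReal_sum_of_nonneg fun x hx => (hw x hx).le, hw1, ENNReal.ofReal_one]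
  · rw [hat x hx]
    exact ENNReal.ofReal_pos.2 (hw x hx)
  · conv_lhs => rw [hξ]
    exact Finset.sum_congr rfl fun x hx => by rw [hat x hx]
  · rw [Measure.real, hat x hx, ENNReal.toReal_ofReal (hw x hx).le]

/-- The quadratic form of the integral of a matrix function against a design. -/
theorem IsDesignOn.dotProduct_matrixIntegral {A B : ℝ} {ξ : Measure ℝ} {s : Finset ℝ}
    (hξ : IsDesignOn A B ξ s) {p : ℕ} (C : ℝ → Matrix (Fin p) (Fin p) ℝ) (Q : Fin p → ℝ) :
    Q ⬝ᵥ (matrixIntegral C ξ *ᵥ Q) = ∑ x ∈ s, ξ.real {x} * (Q ⬝ᵥ (C x *ᵥ Q)) := by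
  simp only [matrixIntegral, Matrix.mulVec, dotProduct, Matrix.of_apply, hξ.integral_eq,
    Finset.mul_sum, Finset.sum_mul]
  rw [Finset.sum_comm_cycle]
  refine Finset.sum_congr rfl fun x _ => Finset.sum_congr rfl fun a _ =>
    Finset.sum_congr rfl fun b _ => by ring

/-- The integral of a symmetric matrix function against a design is symmetric. -/
theorem IsDesignOn.isSymm_matrixIntegral {A B : ℝ} {ξ : Measure ℝ} {s : Finset ℝ}
    (hξ : IsDesignOn A B ξ s) {p : ℕ} {C : ℝ → Matrix (Fin p) (Fin p) ℝ}
    (hC : ∀ x ∈ Set.Icc A B, (C x).IsSymm) : (matrixIntegral C ξ).IsSymm := by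
  ext a b
  simp only [Matrix.transpose_apply, matrixIntegral, Matrix.of_apply, hξ.integral_eq]
  exact Finset.sum_congr rfl fun x hx => by rw [(hC x (hξ.2.1 hx)).apply]

/-- Yang–Stufken part (2), case (b): in the setting of the complete class theorem
(with `-QᵀC₂₂Q` extensions) with `k` even and `I(ξ) ≥ k/2`, the dominating design `ξ⁻`
can be chosen with at most `k/2` support points. -/
theorem complete_class_lower_even
    {k p₁ : ℕ} (hk : 0 < k) (hp : 1 ≤ p₁) (A B : ℝ) (hAB : A < B)
    (Ψ : Fin k → ℝ → ℝ) (C : ℝ → Matrix (Fin p₁) (Fin p₁) ℝ)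
    (hΨ0 : ∀ x : ℝ, Ψ ⟨0, hk⟩ x = 1)
    (hcontΨ : ∀ i, ContinuousOn (Ψ i) (Set.Icc A B))
    (hcontC : ∀ a b, ContinuousOn (fun x => C x a b) (Set.Icc A B))
    (hsymm : ∀ x ∈ Set.Icc A B, (C x).IsSymm)
    (hCheb : IsChebyshevSystem A B Ψ)
    (hChebQ : ∀ Q : Fin p₁ → ℝ, Q ≠ 0 →
      IsChebyshevSystem A B (Fin.snoc Ψ fun x => -(Q ⬝ᵥ ((C x) *ᵥ Q))))
    (ξ : Measure ℝ) (s : Finset ℝ) (hξ : IsDesignOn A B ξ s)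
    (heven : Even k) (hidx : (k : ℝ) / 2 ≤ designIndex A B s) :
    ∃ (ξm : Measure ℝ) (sm : Finset ℝ), IsDesignOn A B ξm sm ∧
      sm.card ≤ k / 2 ∧
      (∀ i, ∫ x, Ψ i x ∂ξm = ∫ x, Ψ i x ∂ξ) ∧
      (matrixIntegral C ξm - matrixIntegral C ξ).PosSemidef := by
  obtain ⟨m, rfl⟩ := heven
  have := hξ.1
  have hmass : ∑ x ∈ s, ξ.real {x} = 1 := by simpa using (hξ.integral_eq fun _ => 1).symm
  have key : ∀ Q : Fin p₁ → ℝ, Q ≠ 0 → ∃ (t : Finset ℝ) (w : ℝ → ℝ), ↑t ⊆ Set.Icc A B ∧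
      (∀ x ∈ t, 0 < w x) ∧ t.card ≤ m ∧
      (∀ i, ∑ x ∈ t, w x * Ψ i x = ∑ x ∈ s, ξ.real {x} * Ψ i x) ∧
      ∑ x ∈ s, ξ.real {x} * (Q ⬝ᵥ (C x *ᵥ Q)) ≤ ∑ x ∈ t, w x * (Q ⬝ᵥ (C x *ᵥ Q)) := by
    intro Q hQ
    have hcontQ : ContinuousOn (fun x => -(Q ⬝ᵥ (C x *ᵥ Q))) (Set.Icc A B) := by
      simp only [dotProduct, Matrix.mulVec]
      fun_prop
    obtain ⟨t, w, ht, hw, hc, hmom, hlast⟩ := (hChebQ Q hQ).exists_card_le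
      (by simpa using hCheb)
      (fun i => by refine Fin.lastCases ?_ (fun i => ?_) i <;> simp [hcontΨ, hcontQ])
      (i₀ := ⟨0, hk⟩) (fun x => by rw [Fin.snoc_castSucc]; exact hΨ0 x) hξ.2.1 (v := fun x => ξ.real {x})
      (fun x _ => measureReal_nonneg) hmass
    refine ⟨t, w, ht, hw, hc, by simpa using hmom, ?_⟩
    simpa using hlast
  obtain ⟨t, w, ht, hw, hc, hmom, -⟩ := key (fun _ => 1) fun h =>
    one_ne_zero (congrFun h ⟨0, hp⟩)
  obtain ⟨ξm, hξm, hwm⟩ := exists_isDesignOn ht hw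
    (by simpa [hΨ0, hmass] using hmom ⟨0, hk⟩)
  have hsum : ∀ f : ℝ → ℝ, ∑ x ∈ t, ξm.real {x} * f x = ∑ x ∈ t, w x * f x := fun f =>
    Finset.sum_congr rfl fun x hx => by rw [hwm x hx]
  refine ⟨ξm, t, hξm, by omega, fun i => ?_, .of_dotProduct_mulVec_nonneg ?_ fun Q => ?_⟩
  · rw [hξm.integral_eq, hξ.integral_eq, hsum, hmom]
  · have h := (hξm.isSymm_matrixIntegral hsymm).sub (hξ.isSymm_matrixIntegral hsymm)
    rwa [Matrix.IsHermitian, Matrix.conjTranspose_eq_transpose_of_trivial]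
  · rcases eq_or_ne Q 0 with rfl | hQ
    · simp
    obtain ⟨t', w', ht', -, hc', hmom', hle⟩ := key Q hQ
    rw [star_trivial, Matrix.sub_mulVec, dotProduct_sub, hξm.dotProduct_matrixIntegral,
      hξ.dotProduct_matrixIntegral, hsum, sub_nonneg]
    exact hle.trans_eq (hCheb.sum_eq_of_card_add_le hAB ht' ht (by omega)
      (fun i => (hmom' i).trans (hmom i).symm) _)
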